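/- arXiv:1001.3908 — 2 statements merged into one kernel-verified Lean document; each statement's English description precedes it below -/
import Mathlib

section
/- (Joint AEP for bipartite sequences, part 3, lower bound.) Let P_{U,U'} and P_{T,T'} be joint distributions on finite alphabets U × U' and T × T', and let A_ε^{(N,n)} be the set of (ε, n)-bipartite jointly typical pairs, N = n + d. Let (X̃^N, Ỹ^N) be a pair of independent bipartite random sequences, where X̃^N = (Ũ^n || T̃^d) has i.i.d. parts drawn from the marginals P_U and P_T, Ỹ^N = (Ũ'^n || T̃'^d) has i.i.d. parts drawn from the marginals P_{U'} and P_{T'}, and X̃^N is independent of Ỹ^N. Then for every ε > 0 there exist n₀, d₀ such that for all n > n₀, d > d₀, Pr((X̃^N, Ỹ^N) ∈ A_ε^{(N,n)}) ≥ (1 − ε)·2^{−n·I(U;U') − d·I(T;T') − 3N·ε}, where I denotes mutual information in bits. -/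
open scoped BigOperators Classical

noncomputable section

/-- `p` is a probability mass function on a finite alphabet. -/
def IsPMF {α : Type*} [Fintype α] (p : α → ℝ) : Prop :=
  (∀ a, 0 ≤ p a) ∧ ∑ a, p a = 1

/-- Shannon entropy (in bits) of a pmf on a finite alphabet. -/
def pmfEntropy {α : Type*} [Fintype α] (p : α → ℝ) : ℝ :=
  -∑ a, p a * Real.logb 2 (p a)

/-- Probability of an i.i.d. `n`-sequence under the pmf `p`. -/
def seqProb {α : Type*} {n : ℕ} (p : α → ℝ) (x : Fin n → α) : ℝ :=
  ∏ i, p (x i)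

/-- A bipartite sequence `x = (u^n ‖ t^d)` is `(ε, n)`-bipartite typical w.r.t. `(pU, pT)`. -/
def BipTypical {U T : Type*} [Fintype U] [Fintype T]
    (pU : U → ℝ) (pT : T → ℝ) (ε : ℝ) {n d : ℕ}
    (x : (Fin n → U) × (Fin d → T)) : Prop :=
  |(-(1 / ((n : ℝ) + (d : ℝ))) * Real.logb 2 (seqProb pU x.1 * seqProb pT x.2)) -
      (((n : ℝ) * pmfEntropy pU + (d : ℝ) * pmfEntropy pT) / ((n : ℝ) + (d : ℝ)))| < ε

/-- A pair of bipartite sequences `(x, y)` is `(ε, n)`-bipartite jointly typical w.r.t. the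
joint pmfs `pUU` on `U × U'` and `pTT` on `T × T'`: each sequence is bipartite typical with
respect to the corresponding marginals, and the pair satisfies the joint typicality bound. -/
def BipJointTypical {U U' T T' : Type*} [Fintype U] [Fintype U'] [Fintype T] [Fintype T']
    (pUU : U × U' → ℝ) (pTT : T × T' → ℝ) (ε : ℝ) {n d : ℕ}
    (x : (Fin n → U) × (Fin d → T)) (y : (Fin n → U') × (Fin d → T')) : Prop :=
  BipTypical (fun u => ∑ u', pUU (u, u')) (fun t => ∑ t', pTT (t, t')) ε x ∧
  BipTypical (fun u' => ∑ u, pUU (u, u')) (fun t' => ∑ t, pTT (t, t')) ε y ∧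
  |(-(1 / ((n : ℝ) + (d : ℝ))) *
      Real.logb 2 ((∏ i, pUU (x.1 i, y.1 i)) * ∏ j, pTT (x.2 j, y.2 j))) -
      (((n : ℝ) * pmfEntropy pUU + (d : ℝ) * pmfEntropy pTT) / ((n : ℝ) + (d : ℝ)))| < ε


/-- Mutual information (in bits) of a joint pmf on a product of finite alphabets. -/
def pmfMutualInfo {α β : Type*} [Fintype α] [Fintype β] (p : α × β → ℝ) : ℝ :=
  pmfEntropy (fun a => ∑ b, p (a, b)) + pmfEntropy (fun b => ∑ a, p (a, b)) - pmfEntropy p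

theorem aux_sum_succ {A : Type*} [Fintype A] (p h : A → ℝ) (n : ℕ)
    (F : ℝ → ℝ → ℝ) :
    ∑ x : Fin (n+1) → A, F (∏ i, p (x i)) (∑ i, h (x i)) =
      ∑ a : A, ∑ x : Fin n → A, F (p a * ∏ i, p (x i)) (h a + ∑ i, h (x i)) := by
  rw [← (Fin.consEquiv (fun _ : Fin (n+1) => A)).sum_comp, Fintype.sum_prod_type]
  simp [Fin.consEquiv, Fin.prod_univ_succ, Fin.sum_univ_succ]

theorem aux_one {A : Type*} [Fintype A] (p : A → ℝ) (hp : ∑ a, p a = 1) (n : ℕ) :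
    ∑ x : Fin n → A, ∏ i, p (x i) = 1 := by
  induction n with
  | zero => simp
  | succ n ih =>
    rw [aux_sum_succ p p n (fun a _ => a)]
    simp_rw [← Finset.mul_sum, ih, mul_one, hp]

theorem aux_mean {A : Type*} [Fintype A] (p h : A → ℝ) (hp : ∑ a, p a = 1)
    (hh : ∑ a, p a * h a = 0) (n : ℕ) :
    ∑ x : Fin n → A, (∏ i, p (x i)) * (∑ i, h (x i)) = 0 := by
  induction n with
  | zero => simp
  | succ n ih =>
    rw [aux_sum_succ p h n (fun a b => a * b)]
    have : ∀ a, ∑ x : Fin n → A, (p a * ∏ i, p (x i)) * (h a + ∑ i, h (x i)) = p a * h a := by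
      intro a
      have e : ∀ x : Fin n → A, (p a * ∏ i, p (x i)) * (h a + ∑ i, h (x i)) =
        (p a * h a) * (∏ i, p (x i)) + p a * ((∏ i, p (x i)) * ∑ i, h (x i)) := by
        intro x; ring
      simp_rw [e, Finset.sum_add_distrib, ← Finset.mul_sum, ih, aux_one p hp]
      ring
    simp_rw [this, hh]

theorem aux_var {A : Type*} [Fintype A] (p h : A → ℝ) (hp : ∑ a, p a = 1)
    (hh : ∑ a, p a * h a = 0) (n : ℕ) :
    ∑ x : Fin n → A, (∏ i, p (x i)) * (∑ i, h (x i)) ^ 2 = n * ∑ a, p a * h a ^ 2 := by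
  induction n with
  | zero => simp
  | succ n ih =>
    rw [aux_sum_succ p h n (fun a b => a * b ^ 2)]
    have : ∀ a, ∑ x : Fin n → A, (p a * ∏ i, p (x i)) * (h a + ∑ i, h (x i)) ^ 2 =
        p a * h a ^ 2 + p a * (n * ∑ a, p a * h a ^ 2) := by
      intro a
      have e : ∀ x : Fin n → A, (p a * ∏ i, p (x i)) * (h a + ∑ i, h (x i)) ^ 2 =
        (p a * h a ^ 2) * (∏ i, p (x i)) + (2 * p a * h a) * ((∏ i, p (x i)) * ∑ i, h (x i))
          + p a * ((∏ i, p (x i)) * (∑ i, h (x i)) ^ 2) := by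
        intro x; ring
      simp_rw [e, Finset.sum_add_distrib, ← Finset.mul_sum, ih, aux_mean p h hp hh, aux_one p hp]
      ring
    simp_rw [this, Finset.sum_add_distrib, ← Finset.sum_mul, hp]
    push_cast; ring

theorem aux_bivar {A B : Type*} [Fintype A] [Fintype B] (p h : A → ℝ) (q g : B → ℝ)
    (hp : ∑ a, p a = 1) (hh : ∑ a, p a * h a = 0)
    (hq : ∑ a, q a = 1) (hg : ∑ a, q a * g a = 0) (n d : ℕ) :
    ∑ z : (Fin n → A) × (Fin d → B), ((∏ i, p (z.1 i)) * ∏ j, q (z.2 j)) *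
      ((∑ i, h (z.1 i)) + ∑ j, g (z.2 j)) ^ 2 =
      n * (∑ a, p a * h a ^ 2) + d * ∑ b, q b * g b ^ 2 := by
  rw [Fintype.sum_prod_type]
  have : ∀ x : Fin n → A, ∑ y : Fin d → B, ((∏ i, p (x i)) * ∏ j, q (y j)) *
      ((∑ i, h (x i)) + ∑ j, g (y j)) ^ 2 =
      (∏ i, p (x i)) * (∑ i, h (x i)) ^ 2 + (∏ i, p (x i)) * (d * ∑ b, q b * g b ^ 2) := by
    intro x
    have e : ∀ y : Fin d → B, ((∏ i, p (x i)) * ∏ j, q (y j)) *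
      ((∑ i, h (x i)) + ∑ j, g (y j)) ^ 2 =
      ((∏ i, p (x i)) * (∑ i, h (x i)) ^ 2) * (∏ j, q (y j))
      + (2 * (∏ i, p (x i)) * (∑ i, h (x i))) * ((∏ j, q (y j)) * ∑ j, g (y j))
      + (∏ i, p (x i)) * ((∏ j, q (y j)) * (∑ j, g (y j)) ^ 2) := by
      intro y; ring
    simp_rw [e, Finset.sum_add_distrib, ← Finset.mul_sum, aux_var q g hq hg, aux_mean q g hq hg,
      aux_one q hq]
    ring
  simp_rw [this, Finset.sum_add_distrib, ← Finset.sum_mul, aux_var p h hp hh, aux_one p hp]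
  ring

/-- Chebyshev for bipartite sequences. -/
theorem aux_cheb {A B : Type*} [Fintype A] [Fintype B] (p f : A → ℝ) (q g : B → ℝ)
    (hp : IsPMF p) (hq : IsPMF q) (ε δ : ℝ) (hε : 0 < ε) (hδ : 0 < δ) :
    ∃ n₀ : ℕ, ∀ n d : ℕ, n > n₀ →
      ∑ z : (Fin n → A) × (Fin d → B),
        (if ε * ((n : ℝ) + d) ≤ |((∑ i, f (z.1 i)) + ∑ j, g (z.2 j)) -
          (n * (∑ a, p a * f a) + d * ∑ b, q b * g b)| then
          (∏ i, p (z.1 i)) * ∏ j, q (z.2 j) else 0) ≤ δ := by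
  set μ := ∑ a, p a * f a with hμ
  set ν := ∑ b, q b * g b with hν
  set V := ∑ a, p a * (f a - μ) ^ 2 with hV
  set W := ∑ b, q b * (g b - ν) ^ 2 with hW
  have hV0 : 0 ≤ V := Finset.sum_nonneg fun a _ => mul_nonneg (hp.1 a) (sq_nonneg _)
  have hW0 : 0 ≤ W := Finset.sum_nonneg fun a _ => mul_nonneg (hq.1 a) (sq_nonneg _)
  obtain ⟨n₀, hn₀⟩ := exists_nat_gt ((V + W) / (ε ^ 2 * δ))
  refine ⟨n₀, fun n d hn => ?_⟩
  have hbv := aux_bivar p (fun a => f a - μ) q (fun b => g b - ν) hp.2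
    (by simp [mul_sub, Finset.sum_sub_distrib, ← Finset.sum_mul, hp.2, hμ]) hq.2
    (by simp [mul_sub, Finset.sum_sub_distrib, ← Finset.sum_mul, hq.2, hν]) n d
  have hnR : (n₀ : ℝ) < n := by exact_mod_cast hn
  have hd0 : (0 : ℝ) ≤ d := Nat.cast_nonneg d
  have hn0' : (0 : ℝ) < n := lt_of_le_of_lt (Nat.cast_nonneg _) hnR
  have hN : 0 < (n : ℝ) + d := by linarith
  have hc : 0 < (ε * ((n : ℝ) + d)) ^ 2 := by positivity
  have key : (ε * ((n : ℝ) + d)) ^ 2 * ∑ z : (Fin n → A) × (Fin d → B),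
        (if ε * ((n : ℝ) + d) ≤ |((∑ i, f (z.1 i)) + ∑ j, g (z.2 j)) -
          (n * μ + d * ν)| then
          (∏ i, p (z.1 i)) * ∏ j, q (z.2 j) else 0) ≤ n * V + d * W := by
    rw [hV, hW, ← hbv, Finset.mul_sum]
    refine Finset.sum_le_sum fun z _ => ?_
    have hw : 0 ≤ (∏ i, p (z.1 i)) * ∏ j, q (z.2 j) :=
      mul_nonneg (Finset.prod_nonneg fun i _ => hp.1 _) (Finset.prod_nonneg fun i _ => hq.1 _)
    split_ifs with hz
    · rw [mul_comm]
      refine mul_le_mul_of_nonneg_left ?_ hw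
      have : (∑ i, (f (z.1 i) - μ)) + ∑ j, (g (z.2 j) - ν) =
        ((∑ i, f (z.1 i)) + ∑ j, g (z.2 j)) - (n * μ + d * ν) := by
        simp [Finset.sum_sub_distrib]; ring
      rw [this, ← sq_abs (_ - _)]
      exact pow_le_pow_left₀ (by positivity) hz 2
    · rw [mul_zero]; exact mul_nonneg hw (sq_nonneg _)
  have h1 : V + W < n * (ε ^ 2 * δ) := by
    rw [div_lt_iff₀ (by positivity)] at hn₀
    have : (n₀ : ℝ) * (ε ^ 2 * δ) ≤ n * (ε ^ 2 * δ) := by gcongr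
    linarith
  have h2 : (n : ℝ) * V + d * W ≤ (ε * ((n : ℝ) + d)) ^ 2 * δ := by
    have a1 : (n : ℝ) * V + d * W ≤ (n + d) * (V + W) := by nlinarith
    have a2 : ((n : ℝ) + d) * (V + W) ≤ (n + d) * (n * (ε ^ 2 * δ)) := by gcongr
    have a3 : ((n : ℝ) + d) * (n * (ε ^ 2 * δ)) ≤ (n + d) * ((n + d) * (ε ^ 2 * δ)) := by
      gcongr; linarith
    calc _ ≤ _ := a1
      _ ≤ _ := a2
      _ ≤ _ := a3
      _ = _ := by ring
  exact le_of_mul_le_mul_left (key.trans h2) hc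

/-- Typicality condition from a sum condition. -/
theorem aux_typ {n d : ℕ} (a : Fin n → ℝ) (b : Fin d → ℝ) (ha : ∀ i, 0 < a i) (hb : ∀ j, 0 < b j)
    (ε h : ℝ) (hN : 0 < (n : ℝ) + d)
    (H : |((∑ i, -Real.logb 2 (a i)) + ∑ j, -Real.logb 2 (b j)) - h| < ε * ((n : ℝ) + d)) :
    |(-(1 / ((n : ℝ) + (d : ℝ))) * Real.logb 2 ((∏ i, a i) * ∏ j, b j)) -
      h / ((n : ℝ) + d)| < ε := by
  rw [Real.logb_mul (Finset.prod_pos fun i _ => ha i).ne' (Finset.prod_pos fun i _ => hb i).ne',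
    Real.logb_prod _ _ (fun i _ => (ha i).ne'), Real.logb_prod _ _ (fun i _ => (hb i).ne')]
  have : (-(1 / ((n : ℝ) + (d : ℝ))) * ((∑ i, Real.logb 2 (a i)) + ∑ j, Real.logb 2 (b j))) -
      h / ((n : ℝ) + d) = (((∑ i, -Real.logb 2 (a i)) + ∑ j, -Real.logb 2 (b j)) - h) /
        ((n : ℝ) + d) := by
    simp only [Finset.sum_neg_distrib]; field_simp; ring
  rw [this, abs_div, abs_of_pos hN, div_lt_iff₀ hN]
  exact H

/-- Bounds from typicality. -/
theorem aux_bd (N L h ε : ℝ) (hN : 0 < N) (H : |(-(1 / N) * L) - h / N| < ε) :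
    -h - N * ε < L ∧ L < -h + N * ε := by
  have : (-(1 / N) * L) - h / N = (-L - h) / N := by field_simp
  rw [this, abs_div, abs_of_pos hN, div_lt_iff₀ hN, abs_lt] at H
  constructor <;> nlinarith

theorem aux_margL {A B : Type*} [Fintype A] [Fintype B] (p : A × B → ℝ) :
    ∑ a, p a * (-Real.logb 2 (∑ b, p (a.1, b))) = pmfEntropy (fun a => ∑ b, p (a, b)) := by
  rw [Fintype.sum_prod_type, pmfEntropy, ← Finset.sum_neg_distrib]
  refine Finset.sum_congr rfl fun a _ => ?_
  dsimp only
  rw [← Finset.sum_mul]; ring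

theorem aux_margR {A B : Type*} [Fintype A] [Fintype B] (p : A × B → ℝ) :
    ∑ a, p a * (-Real.logb 2 (∑ c, p (c, a.2))) = pmfEntropy (fun b => ∑ a, p (a, b)) := by
  rw [Fintype.sum_prod_type_right, pmfEntropy, ← Finset.sum_neg_distrib]
  refine Finset.sum_congr rfl fun a _ => ?_
  dsimp only
  rw [← Finset.sum_mul]; ring

theorem aux_joint {A : Type*} [Fintype A] (p : A → ℝ) :
    ∑ a, p a * (-Real.logb 2 (p a)) = pmfEntropy p := by
  simp [pmfEntropy]

def auxEquiv (U U' T T' : Type*) (n d : ℕ) :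
    ((Fin n → U × U') × (Fin d → T × T')) ≃
      (((Fin n → U) × (Fin d → T)) × ((Fin n → U') × (Fin d → T'))) where
  toFun z := ((fun i => (z.1 i).1, fun j => (z.2 j).1), (fun i => (z.1 i).2, fun j => (z.2 j).2))
  invFun w := (fun i => (w.1.1 i, w.2.1 i), fun j => (w.1.2 j, w.2.2 j))
  left_inv _ := rfl
  right_inv _ := rfl

theorem aux_or {w : ℝ} (hw : 0 ≤ w) {A B C D : Prop} (h : A ∨ B ∨ C ∨ D) :
    w ≤ (if D then w else 0) + (if A then w else 0) + (if B then w else 0) +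
      (if C then w else 0) := by
  have i0 : ∀ P : Prop, 0 ≤ (if P then w else 0) := fun P => by split_ifs <;> simp [hw]
  have := i0 A
  have := i0 B
  have := i0 C
  have := i0 D
  rcases h with h | h | h | h <;> rw [if_pos h] <;> linarith

/-- Joint typical set has large probability. -/
theorem aux_AEP {U U' T T' : Type*}
    [Fintype U] [Fintype U'] [Fintype T] [Fintype T']
    (pUU : U × U' → ℝ) (pTT : T × T' → ℝ) (hUU : IsPMF pUU) (hTT : IsPMF pTT)
    (ε : ℝ) (hε : 0 < ε) : ∃ n₀ : ℕ, ∀ n d : ℕ, n > n₀ →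
      1 - ε ≤ ∑ p : ((Fin n → U) × (Fin d → T)) × ((Fin n → U') × (Fin d → T')),
        if BipJointTypical pUU pTT ε p.1 p.2 then
          (∏ i, pUU (p.1.1 i, p.2.1 i)) * ∏ j, pTT (p.1.2 j, p.2.2 j) else 0 := by
  obtain ⟨n1, h1⟩ := aux_cheb pUU (fun a => -Real.logb 2 (∑ b, pUU (a.1, b)))
    pTT (fun a => -Real.logb 2 (∑ b, pTT (a.1, b))) hUU hTT ε (ε / 3) hε (by positivity)
  obtain ⟨n2, h2⟩ := aux_cheb pUU (fun a => -Real.logb 2 (∑ b, pUU (b, a.2)))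
    pTT (fun a => -Real.logb 2 (∑ b, pTT (b, a.2))) hUU hTT ε (ε / 3) hε (by positivity)
  obtain ⟨n3, h3⟩ := aux_cheb pUU (fun a => -Real.logb 2 (pUU a))
    pTT (fun a => -Real.logb 2 (pTT a)) hUU hTT ε (ε / 3) hε (by positivity)
  refine ⟨n1 + n2 + n3, fun n d hn => ?_⟩
  have h1 := h1 n d (by omega)
  have h2 := h2 n d (by omega)
  have h3 := h3 n d (by omega)
  rw [aux_margL, aux_margL] at h1
  rw [aux_margR, aux_margR] at h2
  rw [aux_joint, aux_joint] at h3
  have hN : 0 < (n : ℝ) + d := by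
    have : 0 < n := by omega
    positivity
  rw [← (auxEquiv U U' T T' n d).sum_comp]
  have hone : ∑ z : (Fin n → U × U') × (Fin d → T × T'),
      (∏ i, pUU (z.1 i)) * ∏ j, pTT (z.2 j) = 1 := by
    rw [Fintype.sum_prod_type]
    simp_rw [← Finset.mul_sum, aux_one pTT hTT.2, mul_one, aux_one pUU hUU.2]
  have hle := Finset.sum_le_sum (s := Finset.univ)
    (f := fun z : (Fin n → U × U') × (Fin d → T × T') => (∏ i, pUU (z.1 i)) * ∏ j, pTT (z.2 j))
    (g := fun z =>
      (if BipJointTypical pUU pTT ε (auxEquiv U U' T T' n d z).1 (auxEquiv U U' T T' n d z).2 then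
        (∏ i, pUU ((auxEquiv U U' T T' n d z).1.1 i, (auxEquiv U U' T T' n d z).2.1 i)) *
          ∏ j, pTT ((auxEquiv U U' T T' n d z).1.2 j, (auxEquiv U U' T T' n d z).2.2 j) else 0) +
      (if ε * ((n : ℝ) + d) ≤ |((∑ i, -Real.logb 2 (∑ b, pUU ((z.1 i).1, b))) +
          ∑ j, -Real.logb 2 (∑ b, pTT ((z.2 j).1, b))) -
          (n * pmfEntropy (fun a => ∑ b, pUU (a, b)) + d * pmfEntropy (fun a => ∑ b, pTT (a, b)))|
        then (∏ i, pUU (z.1 i)) * ∏ j, pTT (z.2 j) else 0) +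
      (if ε * ((n : ℝ) + d) ≤ |((∑ i, -Real.logb 2 (∑ b, pUU (b, (z.1 i).2))) +
          ∑ j, -Real.logb 2 (∑ b, pTT (b, (z.2 j).2))) -
          (n * pmfEntropy (fun a => ∑ b, pUU (b, a)) + d * pmfEntropy (fun a => ∑ b, pTT (b, a)))|
        then (∏ i, pUU (z.1 i)) * ∏ j, pTT (z.2 j) else 0) +
      (if ε * ((n : ℝ) + d) ≤ |((∑ i, -Real.logb 2 (pUU (z.1 i))) +
          ∑ j, -Real.logb 2 (pTT (z.2 j))) - (n * pmfEntropy pUU + d * pmfEntropy pTT)|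
        then (∏ i, pUU (z.1 i)) * ∏ j, pTT (z.2 j) else 0)) (by
    intro z _
    have hw : 0 ≤ (∏ i, pUU (z.1 i)) * ∏ j, pTT (z.2 j) :=
      mul_nonneg (Finset.prod_nonneg fun i _ => hUU.1 _) (Finset.prod_nonneg fun i _ => hTT.1 _)
    have hsame : (∏ i, pUU ((auxEquiv U U' T T' n d z).1.1 i, (auxEquiv U U' T T' n d z).2.1 i)) *
          ∏ j, pTT ((auxEquiv U U' T T' n d z).1.2 j, (auxEquiv U U' T T' n d z).2.2 j) =
        (∏ i, pUU (z.1 i)) * ∏ j, pTT (z.2 j) := rfl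
    rw [hsame]
    rcases hw.eq_or_lt with h0 | h0
    · rw [← h0]; simp
    have hne := mul_ne_zero_iff.1 h0.ne'
    have pa : ∀ i, 0 < pUU (z.1 i) := fun i =>
      lt_of_le_of_ne (hUU.1 _) (Finset.prod_ne_zero_iff.1 hne.1 i (Finset.mem_univ i)).symm
    have pb : ∀ i, 0 < pTT (z.2 i) := fun i =>
      lt_of_le_of_ne (hTT.1 _) (Finset.prod_ne_zero_iff.1 hne.2 i (Finset.mem_univ i)).symm
    have pa1 : ∀ i, 0 < ∑ b, pUU ((z.1 i).1, b) := fun i => (pa i).trans_le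
      (Finset.single_le_sum (f := fun b => pUU ((z.1 i).1, b)) (fun _ _ => hUU.1 _)
        (Finset.mem_univ (z.1 i).2))
    have pa2 : ∀ i, 0 < ∑ b, pUU (b, (z.1 i).2) := fun i => (pa i).trans_le
      (Finset.single_le_sum (f := fun b => pUU (b, (z.1 i).2)) (fun _ _ => hUU.1 _)
        (Finset.mem_univ (z.1 i).1))
    have pb1 : ∀ i, 0 < ∑ b, pTT ((z.2 i).1, b) := fun i => (pb i).trans_le
      (Finset.single_le_sum (f := fun b => pTT ((z.2 i).1, b)) (fun _ _ => hTT.1 _)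
        (Finset.mem_univ (z.2 i).2))
    have pb2 : ∀ i, 0 < ∑ b, pTT (b, (z.2 i).2) := fun i => (pb i).trans_le
      (Finset.single_le_sum (f := fun b => pTT (b, (z.2 i).2)) (fun _ _ => hTT.1 _)
        (Finset.mem_univ (z.2 i).1))
    have T1 := aux_typ _ _ pa1 pb1 ε
      (n * pmfEntropy (fun a => ∑ b, pUU (a, b)) + d * pmfEntropy (fun a => ∑ b, pTT (a, b))) hN
    have T2 := aux_typ _ _ pa2 pb2 ε
      (n * pmfEntropy (fun a => ∑ b, pUU (b, a)) + d * pmfEntropy (fun a => ∑ b, pTT (b, a))) hN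
    have T3 := aux_typ _ _ pa pb ε (n * pmfEntropy pUU + d * pmfEntropy pTT) hN
    rw [← not_le] at T1 T2 T3
    have hJ : ∀ A B C : Prop, (¬ A → _) → (¬ B → _) → (¬ C → _) → (A ∨ B ∨ C ∨
        BipJointTypical pUU pTT ε (auxEquiv U U' T T' n d z).1 (auxEquiv U U' T T' n d z).2) :=
      fun A B C hA hB hC => by
        by_cases a : A
        · exact Or.inl a
        by_cases b : B
        · exact Or.inr (Or.inl b)
        by_cases c : C
        · exact Or.inr (Or.inr (Or.inl c))
        exact Or.inr (Or.inr (Or.inr ⟨hA a, hB b, hC c⟩))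
    have hJ' := hJ _ _ _ T1 T2 T3
    clear hJ T1 T2 T3
    generalize (∏ i, pUU (z.1 i)) * ∏ j, pTT (z.2 j) = w at *
    exact aux_or hw hJ')
  rw [hone, Finset.sum_add_distrib, Finset.sum_add_distrib, Finset.sum_add_distrib] at hle
  linarith

/-- Joint AEP for bipartite sequences, part 3 (lower bound): if `X̃` and `Ỹ` are independent
bipartite random sequences drawn i.i.d. from the marginal distributions, then for every
`ε > 0` and all sufficiently large `n, d`,
`Pr((X̃, Ỹ) ∈ A_ε^{(N,n)}) ≥ (1 − ε)·2^{−n·I(U;U') − d·I(T;T') − 3N·ε}`. -/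
theorem bipartite_joint_AEP_part3_lower {U U' T T' : Type*}
    [Fintype U] [Fintype U'] [Fintype T] [Fintype T']
    (pUU : U × U' → ℝ) (pTT : T × T' → ℝ) (hUU : IsPMF pUU) (hTT : IsPMF pTT) :
    ∀ ε > (0 : ℝ), ∃ n₀ d₀ : ℕ, ∀ n d : ℕ, n > n₀ → d > d₀ →
      (1 - ε) * (2 : ℝ) ^ (-((n : ℝ) * pmfMutualInfo pUU) - (d : ℝ) * pmfMutualInfo pTT -
          3 * ((n : ℝ) + (d : ℝ)) * ε) ≤
        ∑ p ∈ Finset.univ.filter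
            (fun p : ((Fin n → U) × (Fin d → T)) × ((Fin n → U') × (Fin d → T')) =>
              BipJointTypical pUU pTT ε p.1 p.2),
          (seqProb (fun u => ∑ u', pUU (u, u')) p.1.1 *
              seqProb (fun t => ∑ t', pTT (t, t')) p.1.2) *
            (seqProb (fun u' => ∑ u, pUU (u, u')) p.2.1 *
              seqProb (fun t' => ∑ t, pTT (t, t')) p.2.2) := by
  intro ε hε
  obtain ⟨n₀, h₀⟩ := aux_AEP pUU pTT hUU hTT ε hε
  refine ⟨n₀, 0, fun n d hn hd => ?_⟩
  have hN : 0 < (n : ℝ) + d := by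
    have : 0 < n := by omega
    positivity
  refine le_trans (mul_le_mul_of_nonneg_right (h₀ n d hn) (by positivity)) ?_
  rw [Finset.sum_filter, Finset.sum_mul]
  refine Finset.sum_le_sum fun p _ => ?_
  split_ifs with hp
  swap
  · simp
  have nU : ∀ u, 0 ≤ ∑ u', pUU (u, u') := fun u => Finset.sum_nonneg fun _ _ => hUU.1 _
  have nU' : ∀ u', 0 ≤ ∑ u, pUU (u, u') := fun u => Finset.sum_nonneg fun _ _ => hUU.1 _
  have nT : ∀ u, 0 ≤ ∑ u', pTT (u, u') := fun u => Finset.sum_nonneg fun _ _ => hTT.1 _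
  have nT' : ∀ u', 0 ≤ ∑ u, pTT (u, u') := fun u => Finset.sum_nonneg fun _ _ => hTT.1 _
  have lU : ∀ u u', pUU (u, u') ≤ ∑ u', pUU (u, u') := fun u u' =>
    Finset.single_le_sum (f := fun u' => pUU (u, u')) (fun _ _ => hUU.1 _) (Finset.mem_univ u')
  have lU' : ∀ u u', pUU (u, u') ≤ ∑ u, pUU (u, u') := fun u u' =>
    Finset.single_le_sum (f := fun u => pUU (u, u')) (fun _ _ => hUU.1 _) (Finset.mem_univ u)
  have lT : ∀ u u', pTT (u, u') ≤ ∑ u', pTT (u, u') := fun u u' =>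
    Finset.single_le_sum (f := fun u' => pTT (u, u')) (fun _ _ => hTT.1 _) (Finset.mem_univ u')
  have lT' : ∀ u u', pTT (u, u') ≤ ∑ u, pTT (u, u') := fun u u' =>
    Finset.single_le_sum (f := fun u => pTT (u, u')) (fun _ _ => hTT.1 _) (Finset.mem_univ u)
  have e0 : 0 ≤ (∏ i, pUU (p.1.1 i, p.2.1 i)) * ∏ j, pTT (p.1.2 j, p.2.2 j) :=
    mul_nonneg (Finset.prod_nonneg fun i _ => hUU.1 _) (Finset.prod_nonneg fun i _ => hTT.1 _)
  have e1 : (∏ i, pUU (p.1.1 i, p.2.1 i)) * ∏ j, pTT (p.1.2 j, p.2.2 j) ≤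
      seqProb (fun u => ∑ u', pUU (u, u')) p.1.1 * seqProb (fun t => ∑ t', pTT (t, t')) p.1.2 := by
    unfold seqProb
    exact mul_le_mul (Finset.prod_le_prod (fun _ _ => hUU.1 _) fun _ _ => lU _ _)
      (Finset.prod_le_prod (fun _ _ => hTT.1 _) fun _ _ => lT _ _)
      (Finset.prod_nonneg fun _ _ => hTT.1 _) (Finset.prod_nonneg fun _ _ => nU _)
  have e2 : (∏ i, pUU (p.1.1 i, p.2.1 i)) * ∏ j, pTT (p.1.2 j, p.2.2 j) ≤
      seqProb (fun u' => ∑ u, pUU (u, u')) p.2.1 * seqProb (fun t' => ∑ t, pTT (t, t')) p.2.2 := by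
    unfold seqProb
    exact mul_le_mul (Finset.prod_le_prod (fun _ _ => hUU.1 _) fun _ _ => lU' _ _)
      (Finset.prod_le_prod (fun _ _ => hTT.1 _) fun _ _ => lT' _ _)
      (Finset.prod_nonneg fun _ _ => hTT.1 _) (Finset.prod_nonneg fun _ _ => nU' _)
  obtain ⟨t1, t2, t3⟩ := hp
  have b1 := (aux_bd _ _ _ _ hN t1).1
  have b2 := (aux_bd _ _ _ _ hN t2).1
  have b3 := (aux_bd _ _ _ _ hN t3).2
  generalize (∏ i, pUU (p.1.1 i, p.2.1 i)) * ∏ j, pTT (p.1.2 j, p.2.2 j) = w at *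
  generalize seqProb (fun u => ∑ u', pUU (u, u')) p.1.1 *
    seqProb (fun t => ∑ t', pTT (t, t')) p.1.2 = x at *
  generalize seqProb (fun u' => ∑ u, pUU (u, u')) p.2.1 *
    seqProb (fun t' => ∑ t, pTT (t, t')) p.2.2 = y at *
  rcases e0.eq_or_lt with h0 | h0
  · rw [← h0, zero_mul]
    exact mul_nonneg (by linarith) (by linarith)
  have hx : 0 < x := by linarith
  have hy : 0 < y := by linarith
  rw [← Real.logb_le_logb (b := 2) (by norm_num) (by positivity) (by positivity),
    Real.logb_mul h0.ne' (by positivity), Real.logb_mul hx.ne' hy.ne',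
    Real.logb_rpow (by norm_num) (by norm_num)]
  unfold pmfMutualInfo
  linarith
end
end

section
/- (One-round recursion for interactive protocols.) Let A, B, E, X, Y, Z be discrete random variables with finite ranges on a common probability space such that (A, E) ↔ B ↔ X ↔ (Y, Z) forms a Markov chain, i.e., X is conditionally independent of (A, E) given B, and (Y, Z) is conditionally independent of (A, B, E) given X. Then I((B, X); (A, Y) | (E, Z)) ≤ I(X; Y | Z) + I(B; A | E). -/
open scoped BigOperators Classical

noncomputable section

/-- `μ` is a probability mass function on the finite sample space `Ω`. -/
def IsProb {Ω : Type*} [Fintype Ω] (μ : Ω → ℝ) : Prop :=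
  (∀ ω, 0 ≤ μ ω) ∧ ∑ ω, μ ω = 1

/-- The probability that the discrete random variable `X` takes the value `a`. -/
def pr {Ω : Type*} [Fintype Ω] (μ : Ω → ℝ) {α : Type*} (X : Ω → α) (a : α) : ℝ :=
  ∑ ω ∈ Finset.univ.filter (fun ω => X ω = a), μ ω

/-- Shannon entropy (in bits) of a discrete random variable with finite range. -/
def H {Ω : Type*} [Fintype Ω] (μ : Ω → ℝ) {α : Type*} [Fintype α] (X : Ω → α) : ℝ :=
  -∑ a : α, pr μ X a * Real.logb 2 (pr μ X a)

/-- Conditional entropy `H(X | Y) = H(X, Y) − H(Y)` (in bits). -/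
def condH {Ω : Type*} [Fintype Ω] (μ : Ω → ℝ) {α β : Type*} [Fintype α] [Fintype β]
    (X : Ω → α) (Y : Ω → β) : ℝ :=
  H μ (fun ω => (X ω, Y ω)) - H μ Y

/-- Mutual information `I(X; Y) = H(X) + H(Y) − H(X, Y)` (in bits). -/
def MI {Ω : Type*} [Fintype Ω] (μ : Ω → ℝ) {α β : Type*} [Fintype α] [Fintype β]
    (X : Ω → α) (Y : Ω → β) : ℝ :=
  H μ X + H μ Y - H μ (fun ω => (X ω, Y ω))

/-- Conditional mutual information
`I(X; Y | Z) = H(X, Z) + H(Y, Z) − H(X, Y, Z) − H(Z)` (in bits). -/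
def CMI {Ω : Type*} [Fintype Ω] (μ : Ω → ℝ) {α β γ : Type*} [Fintype α] [Fintype β] [Fintype γ]
    (X : Ω → α) (Y : Ω → β) (Z : Ω → γ) : ℝ :=
  H μ (fun ω => (X ω, Z ω)) + H μ (fun ω => (Y ω, Z ω)) -
    H μ (fun ω => (X ω, Y ω, Z ω)) - H μ Z

/-- `X` and `Y` are conditionally independent given `Z`:
`P(X = a, Y = b, Z = c) · P(Z = c) = P(X = a, Z = c) · P(Y = b, Z = c)` for all `a, b, c`. -/
def CondIndep {Ω : Type*} [Fintype Ω] (μ : Ω → ℝ) {α β γ : Type*}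
    (X : Ω → α) (Y : Ω → β) (Z : Ω → γ) : Prop :=
  ∀ a b c, pr μ (fun ω => (X ω, Y ω, Z ω)) (a, b, c) * pr μ Z c =
    pr μ (fun ω => (X ω, Z ω)) (a, c) * pr μ (fun ω => (Y ω, Z ω)) (b, c)

/-- `X` and `Y` are independent: `P(X = a, Y = b) = P(X = a) · P(Y = b)` for all `a, b`. -/
def Indep {Ω : Type*} [Fintype Ω] (μ : Ω → ℝ) {α β : Type*}
    (X : Ω → α) (Y : Ω → β) : Prop :=
  ∀ a b, pr μ (fun ω => (X ω, Y ω)) (a, b) = pr μ X a * pr μ Y b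

theorem pr_nonneg' {Ω : Type*} [Fintype Ω] {μ : Ω → ℝ} (hμ : IsProb μ) {α : Type*}
    (X : Ω → α) (a : α) : 0 ≤ pr μ X a :=
  Finset.sum_nonneg fun ω _ => hμ.1 ω

theorem pr_pos' {Ω : Type*} [Fintype Ω] {μ : Ω → ℝ} (hμ : IsProb μ) {α : Type*}
    (X : Ω → α) (ω : Ω) (h : 0 < μ ω) : 0 < pr μ X (X ω) :=
  lt_of_lt_of_le h (Finset.single_le_sum (f := μ) (fun i _ => hμ.1 i) (by simp))

theorem sum_pr_mul {Ω : Type*} [Fintype Ω] (μ : Ω → ℝ) {α : Type*} [Fintype α]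
    (X : Ω → α) (f : α → ℝ) : ∑ a, pr μ X a * f a = ∑ ω, μ ω * f (X ω) := by
  rw [← Finset.sum_fiberwise (s := Finset.univ) (g := X)]
  refine Finset.sum_congr rfl fun a _ => ?_
  unfold pr
  rw [Finset.sum_mul]
  refine Finset.sum_congr (by ext; simp) fun ω hω => ?_
  simp only [Finset.mem_filter] at hω
  rw [hω.2]

theorem H_eq {Ω : Type*} [Fintype Ω] (μ : Ω → ℝ) {α : Type*} [Fintype α]
    (X : Ω → α) : H μ X = -∑ ω, μ ω * Real.logb 2 (pr μ X (X ω)) := by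
  unfold H
  rw [sum_pr_mul μ X (fun a => Real.logb 2 (pr μ X a))]

theorem H_congr {Ω : Type*} [Fintype Ω] (μ : Ω → ℝ) {α β : Type*} [Fintype α] [Fintype β]
    (X : Ω → α) (Y : Ω → β) (h : ∀ ω ω', X ω = X ω' ↔ Y ω = Y ω') : H μ X = H μ Y := by
  rw [H_eq, H_eq]
  congr 1
  refine Finset.sum_congr rfl fun ω _ => ?_
  congr 2
  unfold pr
  refine Finset.sum_congr ?_ fun _ _ => rfl
  ext ω'
  simp [h]

theorem CMI_eq {Ω : Type*} [Fintype Ω] (μ : Ω → ℝ) {α β γ : Type*} [Fintype α] [Fintype β]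
    [Fintype γ] (X : Ω → α) (Y : Ω → β) (Z : Ω → γ) :
    CMI μ X Y Z = ∑ ω, μ ω *
      (Real.logb 2 (pr μ (fun ω => (X ω, Y ω, Z ω)) (X ω, Y ω, Z ω)) +
        Real.logb 2 (pr μ Z (Z ω)) - Real.logb 2 (pr μ (fun ω => (X ω, Z ω)) (X ω, Z ω))
        - Real.logb 2 (pr μ (fun ω => (Y ω, Z ω)) (Y ω, Z ω))) := by
  unfold CMI
  simp only [H_eq, mul_add, mul_sub, Finset.sum_add_distrib, Finset.sum_sub_distrib]
  ring

theorem CMI_zero {Ω : Type*} [Fintype Ω] {μ : Ω → ℝ} (hμ : IsProb μ) {α β γ : Type*}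
    [Fintype α] [Fintype β] [Fintype γ] (X : Ω → α) (Y : Ω → β) (Z : Ω → γ)
    (h : CondIndep μ X Y Z) : CMI μ X Y Z = 0 := by
  rw [CMI_eq]
  refine Finset.sum_eq_zero fun ω _ => ?_
  rcases (hμ.1 ω).eq_or_lt with h0 | h0
  · rw [← h0, zero_mul]
  · have e := congrArg (Real.logb 2) (h (X ω) (Y ω) (Z ω))
    rw [Real.logb_mul (pr_pos' hμ (fun ω => (X ω, Y ω, Z ω)) ω h0).ne' (pr_pos' hμ Z ω h0).ne',
      Real.logb_mul (pr_pos' hμ (fun ω => (X ω, Z ω)) ω h0).ne'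
        (pr_pos' hμ (fun ω => (Y ω, Z ω)) ω h0).ne'] at e
    rw [e]; ring

theorem sum_pr_pair {Ω : Type*} [Fintype Ω] (μ : Ω → ℝ) {α γ : Type*} [Fintype α]
    (X : Ω → α) (Z : Ω → γ) (c : γ) : ∑ a, pr μ (fun ω => (X ω, Z ω)) (a, c) = pr μ Z c := by
  unfold pr
  rw [← Finset.sum_fiberwise (s := Finset.univ.filter (fun ω => Z ω = c)) (g := X)]
  refine Finset.sum_congr rfl fun a _ => Finset.sum_congr ?_ fun _ _ => rfl
  ext ω
  simp [and_comm]

theorem CMI_nonneg {Ω : Type*} [Fintype Ω] {μ : Ω → ℝ} (hμ : IsProb μ) {α β γ : Type*}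
    [Fintype α] [Fintype β] [Fintype γ] (X : Ω → α) (Y : Ω → β) (Z : Ω → γ) :
    0 ≤ CMI μ X Y Z := by
  have hl : 0 < Real.log 2 := Real.log_pos (by norm_num)
  let q : α × β × γ → ℝ := fun t => pr μ (fun ω => (X ω, Z ω)) (t.1, t.2.2) *
    pr μ (fun ω => (Y ω, Z ω)) (t.2.1, t.2.2) / pr μ Z t.2.2
  let p : α × β × γ → ℝ := pr μ (fun ω => (X ω, Y ω, Z ω))
  have hq0 : ∀ t, 0 ≤ q t := fun t =>
    div_nonneg (mul_nonneg (pr_nonneg' hμ _ _) (pr_nonneg' hμ _ _)) (pr_nonneg' hμ _ _)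
  have hq : ∑ t, q t = 1 := by
    have hz : ∑ c, pr μ Z c = 1 := by
      have := sum_pr_mul μ Z (fun _ => 1)
      simpa [hμ.2] using this
    rw [← hz, Fintype.sum_prod_type]
    simp_rw [Fintype.sum_prod_type]
    simp only [q]
    rw [Finset.sum_comm' (t' := Finset.univ) (s' := fun _ => Finset.univ) (by simp)]
    simp_rw [Finset.sum_comm (s := (Finset.univ : Finset α)) (t := (Finset.univ : Finset γ))]
    rw [Finset.sum_comm]
    refine Finset.sum_congr rfl fun c _ => ?_
    simp_rw [← Finset.sum_div, ← Finset.sum_mul, sum_pr_pair μ X Z c]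
    rw [← Finset.mul_sum, sum_pr_pair μ Y Z c]
    rcases eq_or_ne (pr μ Z c) 0 with h | h
    · simp [h]
    · field_simp
  have hpq : ∑ ω, μ ω * (q (X ω, Y ω, Z ω) / p (X ω, Y ω, Z ω)) ≤ 1 := by
    rw [← sum_pr_mul μ (fun ω => (X ω, Y ω, Z ω)) (fun t => q t / p t), ← hq]
    refine Finset.sum_le_sum fun t _ => ?_
    change p t * (q t / p t) ≤ q t
    rcases eq_or_ne (p t) 0 with h | h
    · simpa [h] using hq0 t
    · rw [mul_div_cancel₀ _ h]
  have key : ∑ ω, μ ω * ((1 - q (X ω, Y ω, Z ω) / p (X ω, Y ω, Z ω)) / Real.log 2)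
      ≤ CMI μ X Y Z := by
    rw [CMI_eq]
    refine Finset.sum_le_sum fun ω _ => ?_
    rcases (hμ.1 ω).eq_or_lt with h0 | h0
    · simp [← h0]
    refine mul_le_mul_of_nonneg_left ?_ h0.le
    have a1 := pr_pos' hμ (fun ω => (X ω, Y ω, Z ω)) ω h0
    have a2 := pr_pos' hμ Z ω h0
    have a3 := pr_pos' hμ (fun ω => (X ω, Z ω)) ω h0
    have a4 := pr_pos' hμ (fun ω => (Y ω, Z ω)) ω h0
    have hq1 : 0 < q (X ω, Y ω, Z ω) := div_pos (mul_pos a3 a4) a2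
    have hp1 : 0 < p (X ω, Y ω, Z ω) := a1
    have h := Real.log_le_sub_one_of_pos (div_pos hq1 hp1)
    rw [Real.log_div hq1.ne' hp1.ne'] at h
    have h' : Real.log (q (X ω, Y ω, Z ω)) = Real.log (pr μ (fun ω => (X ω, Z ω)) (X ω, Z ω)) +
        Real.log (pr μ (fun ω => (Y ω, Z ω)) (Y ω, Z ω)) - Real.log (pr μ Z (Z ω)) := by
      simp only [q]
      rw [Real.log_div (mul_pos a3 a4).ne' a2.ne', Real.log_mul a3.ne' a4.ne']
    simp only [Real.logb]
    rw [← add_div, ← sub_div, ← sub_div]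
    refine div_le_div_of_nonneg_right ?_ hl.le
    have h'' : Real.log (p (X ω, Y ω, Z ω)) =
      Real.log (pr μ (fun ω => (X ω, Y ω, Z ω)) (X ω, Y ω, Z ω)) := rfl
    linarith
  refine le_trans ?_ key
  have : ∑ ω, μ ω * ((1 - q (X ω, Y ω, Z ω) / p (X ω, Y ω, Z ω)) / Real.log 2) =
      (1 - ∑ ω, μ ω * (q (X ω, Y ω, Z ω) / p (X ω, Y ω, Z ω))) / Real.log 2 := by
    rw [← hμ.2, ← Finset.sum_sub_distrib, Finset.sum_div]
    refine Finset.sum_congr rfl fun ω _ => ?_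
    rw [hμ.2]
    ring
  rw [this]
  exact div_nonneg (by linarith) hl.le

/-- One-round recursion for interactive protocols: if `(A, E) ↔ B ↔ X ↔ (Y, Z)` is a Markov
chain, then `I((B, X); (A, Y) | (E, Z)) ≤ I(X; Y | Z) + I(B; A | E)`. -/
theorem one_round_recursion {Ω : Type*} [Fintype Ω] (μ : Ω → ℝ) (hμ : IsProb μ)
    {αA αB αE αX αY αZ : Type*}
    [Fintype αA] [Fintype αB] [Fintype αE] [Fintype αX] [Fintype αY] [Fintype αZ]
    (A : Ω → αA) (B : Ω → αB) (E : Ω → αE) (X : Ω → αX) (Y : Ω → αY) (Z : Ω → αZ)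
    (h1 : CondIndep μ X (fun ω => (A ω, E ω)) B)
    (h2 : CondIndep μ (fun ω => (Y ω, Z ω)) (fun ω => (A ω, B ω, E ω)) X) :
    CMI μ (fun ω => (B ω, X ω)) (fun ω => (A ω, Y ω)) (fun ω => (E ω, Z ω)) ≤
      CMI μ X Y Z + CMI μ B A E := by
  have e1 := CMI_zero hμ _ _ _ h1
  have e2 := CMI_zero hμ _ _ _ h2
  have s0 := CMI_nonneg hμ A Y (fun ω => (E ω, Z ω))
  have s1 := CMI_nonneg hμ A Z E
  have s2 := CMI_nonneg hμ Y E Z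
  have s3 := CMI_nonneg hμ (fun ω => (B ω, E ω)) Z X
  have s4 := CMI_nonneg hμ E X B
  unfold CMI at *
  have c0 := H_congr μ (fun ω => (A ω, Y ω, E ω, Z ω)) (fun ω => (A ω, E ω, Y ω, Z ω))
    (by intro ω ω'; simp only [Prod.mk.injEq]; tauto)
  have c1 := H_congr μ (fun ω => (A ω, Z ω, E ω)) (fun ω => (A ω, E ω, Z ω))
    (by intro ω ω'; simp only [Prod.mk.injEq]; tauto)
  have c2 := H_congr μ (fun ω => (B ω, A ω, E ω)) (fun ω => (A ω, B ω, E ω))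
    (by intro ω ω'; simp only [Prod.mk.injEq]; tauto)
  have c3 := H_congr μ (fun ω => (E ω, B ω)) (fun ω => (B ω, E ω))
    (by intro ω ω'; simp only [Prod.mk.injEq]; tauto)
  have c4 := H_congr μ (fun ω => (E ω, X ω, B ω)) (fun ω => (B ω, E ω, X ω))
    (by intro ω ω'; simp only [Prod.mk.injEq]; tauto)
  have c5 := H_congr μ (fun ω => (X ω, B ω)) (fun ω => (B ω, X ω))
    (by intro ω ω'; simp only [Prod.mk.injEq]; tauto)
  have c6 := H_congr μ (fun ω => (X ω, (A ω, E ω), B ω)) (fun ω => (A ω, B ω, E ω, X ω))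
    (by intro ω ω'; simp only [Prod.mk.injEq]; tauto)
  have c7 := H_congr μ (fun ω => (Y ω, E ω, Z ω)) (fun ω => (E ω, Y ω, Z ω))
    (by intro ω ω'; simp only [Prod.mk.injEq]; tauto)
  have c8 := H_congr μ (fun ω => (Z ω, E ω)) (fun ω => (E ω, Z ω))
    (by intro ω ω'; simp only [Prod.mk.injEq]; tauto)
  have c9 := H_congr μ (fun ω => (Z ω, X ω)) (fun ω => (X ω, Z ω))
    (by intro ω ω'; simp only [Prod.mk.injEq]; tauto)
  have c10 := H_congr μ (fun ω => ((A ω, B ω, E ω), X ω)) (fun ω => (A ω, B ω, E ω, X ω))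
    (by intro ω ω'; simp only [Prod.mk.injEq]; tauto)
  have c11 := H_congr μ (fun ω => ((A ω, E ω), B ω)) (fun ω => (A ω, B ω, E ω))
    (by intro ω ω'; simp only [Prod.mk.injEq]; tauto)
  have c12 := H_congr μ (fun ω => ((A ω, Y ω), E ω, Z ω)) (fun ω => (A ω, E ω, Y ω, Z ω))
    (by intro ω ω'; simp only [Prod.mk.injEq]; tauto)
  have c13 := H_congr μ (fun ω => ((B ω, E ω), X ω)) (fun ω => (B ω, E ω, X ω))
    (by intro ω ω'; simp only [Prod.mk.injEq]; tauto)
  have c14 := H_congr μ (fun ω => ((B ω, E ω), Z ω, X ω)) (fun ω => (B ω, E ω, X ω, Z ω))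
    (by intro ω ω'; simp only [Prod.mk.injEq]; tauto)
  have c15 := H_congr μ (fun ω => ((B ω, X ω), E ω, Z ω)) (fun ω => (B ω, E ω, X ω, Z ω))
    (by intro ω ω'; simp only [Prod.mk.injEq]; tauto)
  have c16 := H_congr μ (fun ω => ((B ω, X ω), (A ω, Y ω), E ω, Z ω)) (fun ω => (A ω, B ω, E ω, X ω, Y ω, Z ω))
    (by intro ω ω'; simp only [Prod.mk.injEq]; tauto)
  have c17 := H_congr μ (fun ω => ((Y ω, Z ω), X ω)) (fun ω => (X ω, Y ω, Z ω))
    (by intro ω ω'; simp only [Prod.mk.injEq]; tauto)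
  have c18 := H_congr μ (fun ω => ((Y ω, Z ω), (A ω, B ω, E ω), X ω)) (fun ω => (A ω, B ω, E ω, X ω, Y ω, Z ω))
    (by intro ω ω'; simp only [Prod.mk.injEq]; tauto)
  linarith
end
end
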